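/- Let k ≥ 1, let Ω ⊂ ℝ^k be compact and convex with λ_k(Ω) > 0, let g : Ω → [0,∞) be concave, and suppose g attains its maximum at a point p ∈ Ω with g(p) > 0. Then for every ε ∈ (0,1), λ_k({x ∈ Ω : g(x) < ε g(p)}) ≤ (1 − (1−ε)^k) λ_k(Ω); in particular, for k = 1 this bound equals ε λ₁(Ω). -/

import Mathlib

open MeasureTheory

open AffineMap in
/-- A homothety with ratio `1 - ε ∈ [0, 1]` centered at a point of a convex set maps the set into
itself. -/
theorem Convex.image_homothety_one_sub_subset {E : Type*} [AddCommGroup E] [Module ℝ E]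
    {s : Set E} (hs : Convex ℝ s) {p : E} (hp : p ∈ s) {ε : ℝ} (hε0 : 0 ≤ ε) (hε1 : ε ≤ 1) :
    homothety p (1 - ε) '' s ⊆ s := by
  rintro _ ⟨y, hy, rfl⟩
  rw [homothety_eq_lineMap]
  exact hs.lineMap_mem hp hy ⟨by linarith, by linarith⟩

open AffineMap in
/-- The sublevel set `{g < ε g(p)}` of a nonnegative concave function on `s` avoids the homothetic
copy of `s` with center `p` and ratio `1 - ε`. -/
theorem ConcaveOn.setOf_lt_mul_subset_diff_homothety {E : Type*} [AddCommGroup E] [Module ℝ E]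
    {s : Set E} {g : E → ℝ} (hg : ConcaveOn ℝ s g) (hg0 : ∀ x ∈ s, 0 ≤ g x) {p : E} (hp : p ∈ s)
    {ε : ℝ} (hε0 : 0 ≤ ε) (hε1 : ε ≤ 1) :
    {x ∈ s | g x < ε * g p} ⊆ s \ homothety p (1 - ε) '' s := by
  rintro _ ⟨hx, hlt⟩
  refine ⟨hx, ?_⟩
  rintro ⟨y, hy, rfl⟩
  have h := hg.2 hp hy hε0 (sub_nonneg.2 hε1) (by ring)
  rw [homothety_eq_lineMap, lineMap_apply_module, sub_sub_cancel] at hlt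
  simp only [smul_eq_mul] at h
  linarith [mul_nonneg (sub_nonneg.2 hε1) (hg0 y hy)]

/-- **Sublevel sets of a concave function on a convex body.** If `g : Ω → [0,∞)` is concave on a
compact convex body `Ω ⊂ ℝ^k` of positive Lebesgue measure, attaining a positive maximum at
`p ∈ Ω`, then for every `ε ∈ (0,1)` the set where `g < ε g(p)` has measure at most
`(1 - (1-ε)^k)` times the measure of `Ω`; in particular for `k = 1` the bound is `ε λ₁(Ω)`. -/
theorem stmt17 (k : ℕ) (hk : 1 ≤ k) (Ω : Set (EuclideanSpace ℝ (Fin k)))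
    (hcpt : IsCompact Ω) (hconv : Convex ℝ Ω) (hΩpos : 0 < volume Ω)
    (g : EuclideanSpace ℝ (Fin k) → ℝ) (hg : ConcaveOn ℝ Ω g)
    (hg0 : ∀ x ∈ Ω, 0 ≤ g x)
    (p : EuclideanSpace ℝ (Fin k)) (hp : p ∈ Ω) (hmax : ∀ x ∈ Ω, g x ≤ g p)
    (hgp : 0 < g p) (ε : ℝ) (hε0 : 0 < ε) (hε1 : ε < 1) :
    volume {x ∈ Ω | g x < ε * g p} ≤ ENNReal.ofReal (1 - (1 - ε) ^ k) * volume Ω ∧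
      (k = 1 → volume {x ∈ Ω | g x < ε * g p} ≤ ENNReal.ofReal ε * volume Ω) := by
  have hle : volume {x ∈ Ω | g x < ε * g p} ≤ ENNReal.ofReal (1 - (1 - ε) ^ k) * volume Ω := by
    have hpow : 0 ≤ (1 - ε) ^ k := pow_nonneg (sub_nonneg.2 hε1.le) k
    have himage : IsCompact (AffineMap.homothety p (1 - ε) '' Ω) :=
      hcpt.image (AffineMap.homothety_continuous p (1 - ε))
    calc volume {x ∈ Ω | g x < ε * g p}
        ≤ volume (Ω \ AffineMap.homothety p (1 - ε) '' Ω) :=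
          measure_mono (hg.setOf_lt_mul_subset_diff_homothety hg0 hp hε0.le hε1.le)
      _ = volume Ω - volume (AffineMap.homothety p (1 - ε) '' Ω) :=
          measure_sdiff (hconv.image_homothety_one_sub_subset hp hε0.le hε1.le)
            himage.measurableSet.nullMeasurableSet himage.measure_lt_top.ne
      _ = ENNReal.ofReal (1 - (1 - ε) ^ k) * volume Ω := by
          rw [Measure.addHaar_image_homothety, finrank_euclideanSpace_fin, abs_of_nonneg hpow,
            ENNReal.ofReal_sub _ hpow, ENNReal.ofReal_one,
            ENNReal.sub_mul fun _ _ => hcpt.measure_lt_top.ne, one_mul]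
  refine ⟨hle, ?_⟩
  rintro rfl
  simpa using hle
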